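/- (Erdős–Kac theorem) For every pair of fixed real numbers a < b, lim_{x → ∞} (1/x) · |{n ≤ x : a ≤ (ω(n) − log log n)/√(log log n) ≤ b}| = (1/√(2π)) ∫_a^b e^{−t²/2} dt. -/

import Mathlib

open Filter Real

lemma log_factorial_eq_sum_primesLE (n : ℕ) :
    Real.log n.factorial = ∑ p ∈ n.primesLE, (n.factorial.factorization p : ℝ) * Real.log p := by
  rw [Real.log_nat_eq_sum_factorization]
  refine Finsupp.sum_of_support_subset _ (fun p hp => ?_) _ (by simp)
  rw [Nat.support_factorization, Nat.mem_primeFactors] at hp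
  exact Nat.mem_primesLE.2 ⟨(hp.1.dvd_factorial).1 hp.2.1, hp.1⟩

lemma div_le_factorization_factorial {n p : ℕ} (hp : p.Prime) :
    n / p ≤ n.factorial.factorization p := by
  rw [Nat.factorization_factorial hp (Nat.lt_succ_of_lt (Nat.lt_add_one (Nat.log p n)))]
  have h := Finset.single_le_sum (f := fun i => n / p ^ i) (s := Finset.Ico 1 (Nat.log p n + 1).succ)
    (fun _ _ => Nat.zero_le _) (a := 1) (by simp)
  simpa using h

/-- **Mertens' first theorem**. -/
theorem abs_sum_log_div_prime_sub_log_le :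
    ∃ C : ℝ, ∀ n : ℕ, 1 ≤ n →
      |∑ p ∈ n.primesLE, Real.log p / p - Real.log n| ≤ C := by
  have hsum : Summable fun m : ℕ => 4 * (m : ℝ) ^ (-(3 / 2) : ℝ) :=
    (Real.summable_nat_rpow.2 (by norm_num)).mul_left 4
  refine ⟨max (Real.log 4) (1 + ∑' m : ℕ, 4 * (m : ℝ) ^ (-(3 / 2) : ℝ)), fun n hn => ?_⟩
  have hn0 : (0 : ℝ) < n := by exact_mod_cast hn
  have hfac := log_factorial_eq_sum_primesLE n
  rw [abs_le']
  constructor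
  · refine le_trans ?_ (le_max_left _ _)
    have h1 : ∑ p ∈ n.primesLE, ((n : ℝ) / p - 1) * Real.log p ≤ Real.log n.factorial := by
      rw [hfac]
      refine Finset.sum_le_sum fun p hp => ?_
      have hp' := Nat.prime_of_mem_primesLE hp
      refine mul_le_mul_of_nonneg_right ?_ (Real.log_natCast_nonneg p)
      have h2 : ((n / p : ℕ) : ℝ) ≤ n.factorial.factorization p := by
        exact_mod_cast div_le_factorization_factorial hp'
      have h3 : (n : ℝ) / p < (n / p : ℕ) + 1 := by
        rw [← Nat.floor_div_eq_div (K := ℝ)]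
        exact Nat.lt_floor_add_one _
      linarith
    have h2 : Real.log n.factorial ≤ n * Real.log n := by
      rw [← Real.log_pow]
      exact Real.log_le_log (by positivity) (by exact_mod_cast Nat.factorial_le_pow n)
    have h3 := Chebyshev.theta_le_log4_mul_x hn0.le
    rw [Chebyshev.theta_eq_sum_primesLE_log] at h3
    have h4 : ∑ p ∈ n.primesLE, ((n : ℝ) / p - 1) * Real.log p =
        n * (∑ p ∈ n.primesLE, Real.log p / p) - ∑ p ∈ n.primesLE, Real.log p := by
      rw [Finset.mul_sum, ← Finset.sum_sub_distrib]
      exact Finset.sum_congr rfl fun p _ => by ring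
    have h5 : n * (∑ p ∈ n.primesLE, Real.log p / p) ≤ n * (Real.log 4 + Real.log n) := by
      linarith
    linarith [le_of_mul_le_mul_left h5 hn0]
  · refine le_trans ?_ (le_max_right _ _)
    have h1 : Real.log n.factorial ≤
        ∑ p ∈ n.primesLE, (n * (Real.log p / p) + n * (4 * (p : ℝ) ^ (-(3 / 2) : ℝ))) := by
      rw [hfac]
      refine Finset.sum_le_sum fun p hp => ?_
      have hp' := Nat.prime_of_mem_primesLE hp
      have hp2 : (2 : ℝ) ≤ p := by exact_mod_cast hp'.two_le
      have hp0 : (0 : ℝ) < p := by linarith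
      have h2 : ((p : ℝ) - 1) * n.factorial.factorization p ≤ n := by
        have := Nat.sub_one_mul_factorization_factorial (n := n) hp'
        have h : (p - 1) * n.factorial.factorization p ≤ n := by omega
        have := (Nat.cast_le (α := ℝ)).2 h
        rwa [Nat.cast_mul, Nat.cast_sub hp'.one_le, Nat.cast_one] at this
      have h3 : (n.factorial.factorization p : ℝ) ≤ n / (p - 1) := by
        rw [le_div_iff₀ (by linarith)]; linarith
      have h4 : Real.log p ≤ 2 * (p : ℝ) ^ (1 / 2 : ℝ) := by
        have := Real.log_le_rpow_div hp0.le (ε := 1 / 2) (by norm_num)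
        linarith
      have h5 : (p : ℝ) ^ (-(3 / 2) : ℝ) = (p : ℝ) ^ (1 / 2 : ℝ) / p ^ 2 := by
        rw [← Real.rpow_natCast (p : ℝ) 2, ← Real.rpow_sub hp0]; norm_num
      have h6 : Real.log p * (1 / (p - 1) - 1 / p) ≤ 4 * (p : ℝ) ^ (-(3 / 2) : ℝ) := by
        rw [h5]
        calc Real.log p * (1 / (p - 1) - 1 / p)
            ≤ 2 * (p : ℝ) ^ (1 / 2 : ℝ) * (2 / p ^ 2) := by
              refine mul_le_mul h4 ?_ ?_ (by positivity)
              · rw [div_sub_div _ _ (by linarith) (by linarith),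
                  div_le_div_iff₀ (by nlinarith) (by positivity)]
                nlinarith
              · rw [sub_nonneg]
                exact one_div_le_one_div_of_le (by linarith) (by linarith)
          _ = _ := by ring
      calc (n.factorial.factorization p : ℝ) * Real.log p
          ≤ n / (p - 1) * Real.log p :=
            mul_le_mul_of_nonneg_right h3 (Real.log_natCast_nonneg p)
        _ = n * (Real.log p / p) + n * (Real.log p * (1 / (p - 1) - 1 / p)) := by ring
        _ ≤ _ := by gcongr
    have h2 := Stirling.le_log_factorial_stirling (n := n) (by omega)
    have h3 : 0 ≤ Real.log n := Real.log_natCast_nonneg n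
    have h4 : 0 ≤ Real.log (2 * π) := Real.log_nonneg (by linarith [Real.pi_gt_three])
    rw [Finset.sum_add_distrib, ← Finset.mul_sum, ← Finset.mul_sum] at h1
    have h5 : ∑ p ∈ n.primesLE, 4 * (p : ℝ) ^ (-(3 / 2) : ℝ) ≤
        ∑' m : ℕ, 4 * (m : ℝ) ^ (-(3 / 2) : ℝ) :=
      hsum.sum_le_tsum _ fun _ _ => by positivity
    have h6 : n * (Real.log n) ≤ n * ((∑ p ∈ n.primesLE, Real.log p / p) + 1 +
        ∑ p ∈ n.primesLE, 4 * (p : ℝ) ^ (-(3 / 2) : ℝ)) := by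
      linarith
    linarith [le_of_mul_le_mul_left h6 hn0]

/-- **Mertens' second theorem**, with a bounded error term. -/
theorem abs_sum_inv_prime_sub_log_log_le :
    ∃ C : ℝ, 0 ≤ C ∧ ∀ n : ℕ, 2 ≤ n →
      |∑ p ∈ n.primesLE, (p : ℝ)⁻¹ - Real.log (Real.log n)| ≤ C := by
  obtain ⟨C, hC⟩ := abs_sum_log_div_prime_sub_log_le
  have hC0 : 0 ≤ C := (abs_nonneg _).trans (hC 1 le_rfl)
  set A : ℕ → ℝ := fun n => ∑ p ∈ n.primesLE, Real.log p / p with hA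
  set L : ℕ → ℝ := fun n => ∑ p ∈ n.primesLE, (p : ℝ)⁻¹ with hL
  set D : ℕ → ℝ := fun n => L n - A n / Real.log n - Real.log (Real.log n) with hD
  have hl2 : 0 < Real.log 2 := Real.log_pos (by norm_num)
  have key : ∀ n : ℕ, 2 ≤ n →
      |D n - D 2| ≤ (C + 1) * (1 / Real.log 2 - 1 / Real.log n) := by
    intro n hn
    induction n, hn using Nat.le_induction with
    | base => simp
    | succ n hn ih =>
      have hn2 : (2 : ℝ) ≤ n := by exact_mod_cast hn
      set u := Real.log n with hu
      set v := Real.log ((n + 1 : ℕ) : ℝ) with hv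
      have hu0 : 0 < u := Real.log_pos (by linarith)
      have huv : u ≤ v := Real.log_le_log (by linarith) (by push_cast; linarith)
      have hv0 : 0 < v := hu0.trans_le huv
      have hvu1 : v - u ≤ 1 := by
        rw [hu, hv, ← Real.log_div (by positivity) (by positivity)]
        refine (Real.log_le_sub_one_of_pos (by positivity)).trans ?_
        rw [sub_le_iff_le_add, div_le_iff₀ (by linarith)]
        push_cast; linarith
      have hstep : L (n + 1) - A (n + 1) / v = L n - A n / v := by
        simp only [hL, hA, Nat.primesLE_succ]
        split_ifs with hp
        · rw [Finset.sum_insert (Nat.notMem_primesLE n), Finset.sum_insert (Nat.notMem_primesLE n),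
            ← hv]
          field_simp
          ring
        · rfl
      have hdiff : D (n + 1) - D n = A n * (1 / u - 1 / v) - (Real.log v - Real.log u) := by
        simp only [hD]
        rw [← hv, ← hu, hstep]
        ring
      have hA' := abs_le.1 (hC n (by omega))
      have hinv : 0 ≤ 1 / u - 1 / v := sub_nonneg.2 (one_div_le_one_div_of_le hu0 huv)
      have hlog1 : Real.log v - Real.log u ≤ (v - u) / u := by
        rw [← Real.log_div hv0.ne' hu0.ne', sub_div, div_self hu0.ne']
        exact Real.log_le_sub_one_of_pos (by positivity)
      have hlog2 : (v - u) / v ≤ Real.log v - Real.log u := by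
        have := Real.log_le_sub_one_of_pos (x := u / v) (by positivity)
        rw [Real.log_div hu0.ne' hv0.ne'] at this
        rw [sub_div, div_self hv0.ne']
        linarith
      have e1 : (v - u) / v = u * (1 / u - 1 / v) := by field_simp
      have e2 : (v - u) / u = u * (1 / u - 1 / v) + (v - u) * (1 / u - 1 / v) := by
        field_simp; ring
      have hb : |D (n + 1) - D n| ≤ (C + 1) * (1 / u - 1 / v) := by
        rw [hdiff, abs_le]
        have : (v - u) * (1 / u - 1 / v) ≤ 1 * (1 / u - 1 / v) :=
          mul_le_mul_of_nonneg_right hvu1 hinv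
        constructor <;> nlinarith
      calc |D (n + 1) - D 2| = |(D (n + 1) - D n) + (D n - D 2)| := by ring_nf
        _ ≤ _ := abs_add_le _ _
        _ ≤ _ := by linarith
  refine ⟨|D 2| + (C + 1) * (1 / Real.log 2) + 1 + C / Real.log 2, by positivity, fun n hn => ?_⟩
  have hn2 : (2 : ℝ) ≤ n := by exact_mod_cast hn
  have hlog : Real.log 2 ≤ Real.log n := Real.log_le_log (by norm_num) hn2
  have hlog0 : 0 < Real.log n := hl2.trans_le hlog
  have h1 := key n hn
  have h2 : |A n / Real.log n - 1| ≤ C / Real.log 2 := by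
    have : A n / Real.log n - 1 = (A n - Real.log n) / Real.log n := by field_simp
    rw [this, abs_div, abs_of_pos hlog0]
    exact div_le_div₀ hC0 (hC n (by omega)) hl2 hlog
  have h3 : 0 ≤ (C + 1) * (1 / Real.log n) := by positivity
  have h4 : L n - Real.log (Real.log n) = (D n - D 2) + D 2 + (A n / Real.log n - 1) + 1 := by
    simp only [hD]; ring
  change |L n - _| ≤ _
  rw [h4]
  refine (abs_add_le _ _).trans ?_
  rw [abs_one]
  have h5 := abs_add_three (D n - D 2) (D 2) (A n / Real.log n - 1)
  linarith

lemma sum_prod_ite_dvd_eq_div {T : Finset ℕ} (hT : ∀ p ∈ T, p.Prime) (N : ℕ) :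
    ∑ m ∈ Finset.Icc 1 N, ∏ p ∈ T, (if p ∣ m then (1 : ℂ) else 0) = (N / ∏ p ∈ T, p : ℕ) := by
  have h : ∀ m, ∏ p ∈ T, (if p ∣ m then (1 : ℂ) else 0) = if ∏ p ∈ T, p ∣ m then 1 else 0 := by
    intro m
    rw [Finset.prod_ite_zero]
    have : (∀ p ∈ T, p ∣ m) ↔ ∏ p ∈ T, p ∣ m :=
      ⟨Finset.prod_primes_dvd m fun p hp => (hT p hp).prime,
        fun h p hp => (Finset.dvd_prod_of_mem _ hp).trans h⟩
    simp [this]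
  simp_rw [h]
  rw [Finset.sum_boole, ← Nat.Ioc_filter_dvd_card_eq_div]
  rfl

lemma norm_div_sub_inv_le {N : ℕ} (hN : N ≠ 0) (d : ℕ) :
    ‖((N / d : ℕ) : ℂ) / N - (d : ℂ)⁻¹‖ ≤ (N : ℝ)⁻¹ ∧
      ‖((N / d : ℕ) : ℂ) / N - (d : ℂ)⁻¹‖ ≤ (d : ℝ)⁻¹ := by
  have hN0 : (0 : ℝ) < N := by positivity
  have h1 : ((N / d : ℕ) : ℝ) ≤ N / d := Nat.cast_div_le
  have h2 : (N : ℝ) / d < (N / d : ℕ) + 1 := by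
    rw [← Nat.floor_div_eq_div (K := ℝ)]
    exact Nat.lt_floor_add_one _
  have h3 : ‖((N / d : ℕ) : ℂ) / N - (d : ℂ)⁻¹‖ = (d : ℝ)⁻¹ - ((N / d : ℕ) : ℝ) / N := by
    have : ((N / d : ℕ) : ℂ) / N - (d : ℂ)⁻¹ = ((((N / d : ℕ) : ℝ) / N - (d : ℝ)⁻¹ : ℝ) : ℂ) := by
      push_cast; rfl
    rw [this, Complex.norm_real, Real.norm_eq_abs, abs_sub_comm, abs_of_nonneg]
    rw [sub_nonneg, div_le_iff₀ hN0, inv_mul_eq_div]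
    exact h1
  rw [h3]
  constructor
  · rw [sub_le_iff_le_add, ← one_div (N : ℝ), ← add_div, le_div_iff₀ hN0, inv_mul_eq_div]
    linarith
  · have : 0 ≤ ((N / d : ℕ) : ℝ) / N := by positivity
    linarith

/-- The averages of `(1 + z) ^ #{p ∈ P | p ∣ m}` over `m ≤ N` are close to the value they would have
if the divisibility events were independent. -/
theorem norm_average_pow_sub_prod_le {P : Finset ℕ} (hP : ∀ p ∈ P, p.Prime) {N : ℕ} (hN : N ≠ 0)
    {z : ℂ} (hz : ‖z‖ ≤ 1) (K : ℝ) {Y : ℝ} (hY : 1 ≤ Y) (hPY : P.card ≤ Y) :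
    ‖(∑ m ∈ Finset.Icc 1 N, (1 + z) ^ (P.filter (· ∣ m)).card) / N - ∏ p ∈ P, (1 + z / p)‖ ≤
      Real.exp 1 * Y ^ K / N + Real.exp (Real.exp 1 * ‖z‖ * ∑ p ∈ P, (p : ℝ)⁻¹ - K) := by
  have hN0 : (0 : ℝ) < N := by positivity
  have hY0 : 0 < Y := by linarith
  have h1 : ∑ m ∈ Finset.Icc 1 N, (1 + z) ^ (P.filter (· ∣ m)).card =
      ∑ T ∈ P.powerset, z ^ T.card * ((N / ∏ p ∈ T, p : ℕ) : ℂ) := by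
    have h (m : ℕ) : (1 + z) ^ (P.filter (· ∣ m)).card =
        ∑ T ∈ P.powerset, z ^ T.card * ∏ p ∈ T, (if p ∣ m then (1 : ℂ) else 0) := by
      have : (1 + z) ^ (P.filter (· ∣ m)).card = ∏ p ∈ P, (1 + z * if p ∣ m then 1 else 0) := by
        rw [← Finset.prod_const, Finset.prod_filter]
        exact Finset.prod_congr rfl fun p _ => by split_ifs <;> simp
      rw [this, Finset.prod_one_add]
      exact Finset.sum_congr rfl fun T _ => by rw [Finset.prod_mul_distrib, Finset.prod_const]
    simp_rw [h]
    rw [Finset.sum_comm]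
    refine Finset.sum_congr rfl fun T hT => ?_
    rw [← Finset.mul_sum,
      sum_prod_ite_dvd_eq_div fun p hp => hP p (Finset.mem_powerset.1 hT hp)]
  have h2 : ∏ p ∈ P, (1 + z / p) =
      ∑ T ∈ P.powerset, z ^ T.card * ((∏ p ∈ T, p : ℕ) : ℂ)⁻¹ := by
    rw [Finset.prod_one_add]
    refine Finset.sum_congr rfl fun T _ => ?_
    simp_rw [div_eq_mul_inv]
    rw [Finset.prod_mul_distrib, Finset.prod_const, Nat.cast_prod, Finset.prod_inv_distrib]
  have hterm : ∀ T ∈ P.powerset,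
      ‖z ^ T.card * ((N / ∏ p ∈ T, p : ℕ) : ℂ) / N - z ^ T.card * ((∏ p ∈ T, p : ℕ) : ℂ)⁻¹‖ ≤
      Y ^ K / N * ∏ p ∈ T, Y⁻¹ + Real.exp (-K) * ∏ p ∈ T, (Real.exp 1 * ‖z‖ * (p : ℝ)⁻¹) := by
    intro T _
    rw [mul_div_assoc, ← mul_sub, norm_mul, norm_pow]
    have h := norm_div_sub_inv_le hN (∏ p ∈ T, p)
    have hzT : ‖z‖ ^ T.card ≤ 1 := pow_le_one₀ (norm_nonneg z) hz
    rcases le_or_gt (T.card : ℝ) K with hTK | hTK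
    · calc _ ≤ 1 * (N : ℝ)⁻¹ := by gcongr; exact h.1
        _ ≤ Y ^ (K - T.card) * (N : ℝ)⁻¹ := by
          gcongr; exact Real.one_le_rpow hY (by linarith)
        _ = Y ^ K / N * ∏ p ∈ T, Y⁻¹ := by
          rw [Finset.prod_const, Real.rpow_sub hY0, Real.rpow_natCast, inv_pow]; ring
        _ ≤ _ := le_add_of_nonneg_right (by positivity)
    · calc _ ≤ ‖z‖ ^ T.card * ((∏ p ∈ T, p : ℕ) : ℝ)⁻¹ := by gcongr; exact h.2
        _ ≤ Real.exp (T.card - K) * (‖z‖ ^ T.card * ((∏ p ∈ T, p : ℕ) : ℝ)⁻¹) :=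
          le_mul_of_one_le_left (by positivity) (Real.one_le_exp (by linarith))
        _ = Real.exp (-K) * ∏ p ∈ T, (Real.exp 1 * ‖z‖ * (p : ℝ)⁻¹) := by
          rw [Finset.prod_mul_distrib, Finset.prod_const, mul_pow, ← Real.exp_nat_mul,
            Finset.prod_inv_distrib, Nat.cast_prod, mul_one, sub_eq_add_neg, Real.exp_add]
          ring
        _ ≤ _ := le_add_of_nonneg_left (by positivity)
  have h3 : ∏ p ∈ P, (1 + Y⁻¹) ≤ Real.exp 1 := by
    calc ∏ p ∈ P, (1 + Y⁻¹) ≤ ∏ p ∈ P, Real.exp Y⁻¹ :=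
          Finset.prod_le_prod (fun _ _ => by positivity)
            fun _ _ => by linarith [Real.add_one_le_exp Y⁻¹]
      _ = Real.exp (P.card * Y⁻¹) := by rw [Finset.prod_const, ← Real.exp_nat_mul]
      _ ≤ Real.exp 1 := by
        gcongr
        rw [← div_eq_mul_inv]
        exact div_le_one_of_le₀ hPY hY0.le
  have h4 : ∏ p ∈ P, (1 + Real.exp 1 * ‖z‖ * (p : ℝ)⁻¹) ≤
      Real.exp (Real.exp 1 * ‖z‖ * ∑ p ∈ P, (p : ℝ)⁻¹) := by
    rw [Finset.mul_sum, Real.exp_sum]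
    exact Finset.prod_le_prod (fun _ _ => by positivity)
      fun p _ => by linarith [Real.add_one_le_exp (Real.exp 1 * ‖z‖ * (p : ℝ)⁻¹)]
  rw [h1, h2, Finset.sum_div, ← Finset.sum_sub_distrib]
  refine (norm_sum_le_of_le _ hterm).trans ?_
  rw [Finset.sum_add_distrib, ← Finset.mul_sum, ← Finset.mul_sum, ← Finset.prod_one_add,
    ← Finset.prod_one_add]
  refine add_le_add ?_ ?_
  · rw [mul_comm (Real.exp 1), mul_div_right_comm]
    gcongr
  · rw [sub_eq_neg_add, Real.exp_add]
    gcongr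

/-- Replacing `∏ (1 + z / p)` by `exp (z ∑ 1 / p)`. -/
theorem exists_prod_one_add_div_eq_exp :
    ∃ C : ℝ, 0 ≤ C ∧ ∀ (P : Finset ℕ) (z : ℂ), (∀ p ∈ P, p.Prime) → ‖z‖ ≤ 1 →
      ∃ w : ℂ, ‖w‖ ≤ C * ‖z‖ ^ 2 ∧
        ∏ p ∈ P, (1 + z / p) = Complex.exp (z * (∑ p ∈ P, (p : ℝ)⁻¹ : ℝ) + w) := by
  have hsum : Summable fun m : ℕ => ((m : ℝ) ^ 2)⁻¹ := Real.summable_nat_pow_inv.2 (by norm_num)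
  refine ⟨∑' m : ℕ, ((m : ℝ) ^ 2)⁻¹, tsum_nonneg fun _ => by positivity, fun P z hP hz => ?_⟩
  refine ⟨∑ p ∈ P, (Complex.log (1 + z / p) - z / p), ?_, ?_⟩
  · calc _ ≤ ∑ p ∈ P, ((p : ℝ) ^ 2)⁻¹ * ‖z‖ ^ 2 := by
          refine norm_sum_le_of_le _ fun p hp => ?_
          have hp2 : (2 : ℝ) ≤ p := by exact_mod_cast (hP p hp).two_le
          have h1 : ‖z / p‖ = ‖z‖ / p := by rw [norm_div, Complex.norm_natCast]
          have h2 : ‖z / p‖ ≤ 1 / 2 := by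
            rw [h1]; exact div_le_div₀ zero_le_one hz two_pos hp2
          refine (Complex.norm_log_one_add_sub_self_le (by linarith)).trans ?_
          have h3 : (1 - ‖z / p‖)⁻¹ ≤ 2 := by
            rw [inv_le_comm₀ (by linarith) two_pos]; linarith
          calc ‖z / p‖ ^ 2 * (1 - ‖z / p‖)⁻¹ / 2 ≤ ‖z / p‖ ^ 2 * 2 / 2 := by gcongr
            _ = _ := by rw [h1]; ring
      _ ≤ _ := by
          rw [← Finset.sum_mul]
          gcongr
          exact hsum.sum_le_tsum _ fun _ _ => by positivity
  · have h : z * ((∑ p ∈ P, (p : ℝ)⁻¹ : ℝ) : ℂ) + ∑ p ∈ P, (Complex.log (1 + z / p) - z / p) =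
        ∑ p ∈ P, Complex.log (1 + z / p) := by
      push_cast
      rw [Finset.mul_sum, ← Finset.sum_add_distrib]
      exact Finset.sum_congr rfl fun p _ => by ring
    rw [h, Complex.exp_sum]
    refine Finset.prod_congr rfl fun p hp => (Complex.exp_log fun h0 => ?_).symm
    have hp2 : (2 : ℝ) ≤ p := by exact_mod_cast (hP p hp).two_le
    have h1 : ‖z / p‖ = 1 := by
      rw [show z / p = -1 by linear_combination h0]; simp
    rw [norm_div, Complex.norm_natCast, div_eq_one_iff_eq (by linarith)] at h1
    linarith

lemma tendsto_log_log_natCast : Tendsto (fun N : ℕ => Real.log (Real.log N)) atTop atTop :=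
  Real.tendsto_log_atTop.comp (Real.tendsto_log_atTop.comp tendsto_natCast_atTop_atTop)

/-- `N ^ (1 / (2 log log N))`, rounded down. Products of up to `log log N` primes below this bound
are at most `√N`. -/
noncomputable def primeCutoff (N : ℕ) : ℕ :=
  ⌊Real.exp (Real.log N / (2 * Real.log (Real.log N)))⌋₊

lemma tendsto_add_log_div_sqrt (C : ℝ) :
    Tendsto (fun u : ℝ => (C + Real.log (4 * u)) / √u) atTop (nhds 0) := by
  have h1 : Tendsto (fun u : ℝ => (C + Real.log 4) / √u) atTop (nhds 0) :=
    tendsto_const_nhds.div_atTop tendsto_sqrt_atTop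
  have h2 : Tendsto (fun u : ℝ => Real.log u / √u) atTop (nhds 0) := by
    simpa [Real.sqrt_eq_rpow] using
      (isLittleO_log_rpow_atTop (r := 1 / 2) (by norm_num)).tendsto_div_nhds_zero
  have h3 := h1.add h2
  rw [add_zero] at h3
  refine h3.congr' ?_
  filter_upwards [eventually_gt_atTop 0] with u hu
  rw [Real.log_mul (by norm_num) hu.ne']
  ring

lemma tendsto_sum_inv_prime_sub_log_log_div_sqrt :
    Tendsto (fun N : ℕ => (∑ p ∈ N.primesLE, (p : ℝ)⁻¹ - Real.log (Real.log N)) /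
      √(Real.log (Real.log N))) atTop (nhds 0) := by
  obtain ⟨C, -, hC⟩ := abs_sum_inv_prime_sub_log_log_le
  have h : Tendsto (fun N : ℕ => C / √(Real.log (Real.log N))) atTop (nhds 0) :=
    tendsto_const_nhds.div_atTop (tendsto_sqrt_atTop.comp tendsto_log_log_natCast)
  refine squeeze_zero_norm' ?_ h
  filter_upwards [eventually_ge_atTop 2] with N hN
  rw [norm_div, Real.norm_eq_abs, Real.norm_of_nonneg (Real.sqrt_nonneg _)]
  exact div_le_div_of_nonneg_right (hC N hN) (Real.sqrt_nonneg _)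

lemma primeCutoff_le_exp (N : ℕ) :
    (primeCutoff N : ℝ) ≤ Real.exp (Real.log N / (2 * Real.log (Real.log N))) :=
  Nat.floor_le (Real.exp_pos _).le

lemma eventually_primeCutoff_le : ∀ᶠ N : ℕ in atTop, primeCutoff N ≤ N := by
  filter_upwards [tendsto_log_log_natCast.eventually_ge_atTop 1, eventually_ge_atTop 1]
    with N hl hN
  have hN1 : (1 : ℝ) ≤ N := by exact_mod_cast hN
  have h1 := primeCutoff_le_exp N
  have h2 : Real.exp (Real.log N / (2 * Real.log (Real.log N))) ≤ N := by
    rw [← Real.le_log_iff_exp_le (by linarith)]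
    exact div_le_self (Real.log_nonneg hN1) (by linarith)
  exact_mod_cast h1.trans h2

lemma tendsto_sum_inv_primeCutoff_sub_log_log_div_sqrt :
    Tendsto (fun N : ℕ => (∑ p ∈ (primeCutoff N).primesLE, (p : ℝ)⁻¹ - Real.log (Real.log N)) /
      √(Real.log (Real.log N))) atTop (nhds 0) := by
  obtain ⟨C, hC0, hC⟩ := abs_sum_inv_prime_sub_log_log_le
  have h := (tendsto_add_log_div_sqrt C).comp tendsto_log_log_natCast
  refine squeeze_zero_norm' ?_ h
  have hlogN : Tendsto (fun N : ℕ => Real.log N) atTop atTop :=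
    Real.tendsto_log_atTop.comp tendsto_natCast_atTop_atTop
  have hsmall : ∀ᶠ N : ℕ in atTop, Real.log (Real.log N) ≤ 1 / 8 * Real.log N := by
    have := (Real.isLittleO_log_id_atTop.comp_tendsto hlogN).bound (c := 1 / 8) (by norm_num)
    filter_upwards [this, hlogN.eventually_ge_atTop 0] with N h h0
    simp only [Function.comp, id] at h
    rw [Real.norm_of_nonneg h0] at h
    exact (le_abs_self _).trans h
  filter_upwards [tendsto_log_log_natCast.eventually_ge_atTop 1, hsmall,
    hlogN.eventually_ge_atTop 1] with N hl hs hlog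
  set l := Real.log (Real.log N) with hldef
  set e := Real.log N / (2 * l) with he
  have he4 : 4 ≤ e := by
    rw [he, le_div_iff₀ (by linarith)]; linarith
  have hexp : 4 ≤ Real.exp e := by linarith [Real.add_one_le_exp e]
  have hle := primeCutoff_le_exp N
  have hlt : Real.exp e < primeCutoff N + 1 := Nat.lt_floor_add_one _
  rw [← hldef, ← he] at hle
  have hge : Real.exp e / 2 ≤ primeCutoff N := by linarith
  have h2 : 2 ≤ primeCutoff N := by
    have : (2 : ℝ) ≤ primeCutoff N := by linarith
    exact_mod_cast this
  have hlog_le : Real.log (primeCutoff N) ≤ e := by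
    rw [Real.log_le_iff_le_exp (by positivity)]; exact hle
  have hlog_ge : e / 2 ≤ Real.log (primeCutoff N) := by
    have h3 := Real.log_le_log (by positivity) hge
    rw [Real.log_div (Real.exp_pos e).ne' two_ne_zero, Real.log_exp] at h3
    have := Real.log_two_lt_d9
    linarith
  have hll_le : Real.log (Real.log (primeCutoff N)) ≤ l := by
    refine Real.log_le_log (by linarith) (hlog_le.trans ?_)
    exact div_le_self (by linarith) (by linarith)
  have hll_ge : l - Real.log (4 * l) ≤ Real.log (Real.log (primeCutoff N)) := by
    have h3 : e / 2 = Real.log N / (4 * l) := by rw [he]; ring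
    rw [hldef, ← Real.log_div (by linarith) (by linarith), ← h3]
    exact Real.log_le_log (by linarith) hlog_ge
  have h4 : 0 ≤ Real.log (4 * l) := Real.log_nonneg (by linarith)
  have h5 := abs_le.1 (hC _ h2)
  simp only [Function.comp]
  rw [norm_div, Real.norm_eq_abs, Real.norm_of_nonneg (Real.sqrt_nonneg _)]
  refine div_le_div_of_nonneg_right (abs_le.2 ⟨?_, ?_⟩) (Real.sqrt_nonneg _) <;> linarith

lemma exp_log_div_rpow_log_log {N : ℕ} (hN : 3 ≤ N) :
    Real.exp (Real.log N / (2 * Real.log (Real.log N))) ^ Real.log (Real.log N) = √N := by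
  have hN0 : (0 : ℝ) < N := by positivity
  have h1 : 1 < Real.log N := by
    rw [Real.lt_log_iff_exp_lt hN0]
    have : (3 : ℝ) ≤ N := by exact_mod_cast hN
    linarith [Real.exp_one_lt_d9]
  have h2 : 0 < Real.log (Real.log N) := Real.log_pos h1
  rw [← Real.exp_mul, Real.sqrt_eq_rpow, Real.rpow_def_of_pos hN0]
  congr 1
  field_simp

lemma tendsto_exp_sub_one_sub_div (t : ℝ) :
    Tendsto (fun s : ℝ => (Complex.exp (t / s * Complex.I) - 1 - t / s * Complex.I) * s ^ 2) atTop
      (nhds (-(t : ℂ) ^ 2 / 2)) := by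
  rw [tendsto_iff_norm_sub_tendsto_zero]
  have hlim : Tendsto (fun s : ℝ => |t| ^ 3 / s) atTop (nhds 0) :=
    tendsto_const_nhds.div_atTop tendsto_id
  refine squeeze_zero' (Eventually.of_forall fun _ => norm_nonneg _) ?_ hlim
  filter_upwards [eventually_ge_atTop (max 1 |t|)] with s hs
  have hs1 : 1 ≤ s := (le_max_left _ _).trans hs
  have hst : |t| ≤ s := (le_max_right _ _).trans hs
  have hs0 : 0 < s := by linarith
  have hsC : (s : ℂ) ≠ 0 := by exact_mod_cast hs0.ne'
  have hn : ‖(t / s * Complex.I : ℂ)‖ = |t| / s := by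
    rw [norm_mul, Complex.norm_I, mul_one, norm_div, Complex.norm_real, Complex.norm_real,
      Real.norm_eq_abs, Real.norm_of_nonneg hs0.le]
  have hb := Complex.exp_bound (x := t / s * Complex.I) (n := 3)
    (by rw [hn]; exact div_le_one_of_le₀ hst hs0.le) (by norm_num)
  rw [hn] at hb
  have h1 : (Complex.exp (t / s * Complex.I) - 1 - t / s * Complex.I) * s ^ 2 - (-t ^ 2 / 2) =
      (Complex.exp (t / s * Complex.I) -
        ∑ m ∈ Finset.range 3, (t / s * Complex.I) ^ m / (m.factorial : ℂ)) * s ^ 2 := by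
    simp only [Finset.sum_range_succ, Finset.sum_range_zero, Nat.factorial, mul_pow, Complex.I_sq]
    push_cast
    field_simp
    ring
  rw [h1, norm_mul, norm_pow, Complex.norm_real, Real.norm_of_nonneg hs0.le]
  calc _ ≤ (|t| / s) ^ 3 * ((Nat.succ 3 : ℕ) * ((Nat.factorial 3 : ℕ) * (3 : ℕ) : ℝ)⁻¹) * s ^ 2 := by
        gcongr
    _ ≤ (|t| / s) ^ 3 * 1 * s ^ 2 := by
        gcongr
        norm_num [Nat.factorial]
    _ = |t| ^ 3 / s := by field_simp

lemma norm_exp_div_mul_I_sub_one_le (t : ℝ) {s : ℝ} (hs : 0 < s) :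
    ‖Complex.exp (t / s * Complex.I) - 1‖ ≤ |t| / s := by
  have := Real.norm_exp_I_mul_ofReal_sub_one_le (x := t / s)
  rw [mul_comm, Real.norm_eq_abs, abs_div, abs_of_pos hs] at this
  simpa using this

/-- The normalized exponential of the independent model tends to the Gaussian one. -/
lemma tendsto_exp_neg_mul_prod_primeCutoff (t : ℝ) :
    Tendsto (fun N : ℕ => Complex.exp (-(t * √(Real.log (Real.log N)) * Complex.I)) *
      ∏ p ∈ (primeCutoff N).primesLE,
        (1 + (Complex.exp (t / √(Real.log (Real.log N)) * Complex.I) - 1) / p)) atTop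
      (nhds (Complex.exp (-t ^ 2 / 2))) := by
  obtain ⟨C, hC0, hC⟩ := exists_prod_one_add_div_eq_exp
  have hs : Tendsto (fun N : ℕ => √(Real.log (Real.log N))) atTop atTop :=
    tendsto_sqrt_atTop.comp tendsto_log_log_natCast
  have hprime : ∀ N, ∀ p ∈ (primeCutoff N).primesLE, p.Prime :=
    fun N p hp => Nat.prime_of_mem_primesLE hp
  set s : ℕ → ℝ := fun N => √(Real.log (Real.log N)) with hsdef
  set z : ℕ → ℂ := fun N => Complex.exp (t / s N * Complex.I) - 1 with hz
  set L : ℕ → ℝ := fun N => ∑ p ∈ (primeCutoff N).primesLE, (p : ℝ)⁻¹ with hL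
  have hex : ∀ N, ∃ w : ℂ, ‖z N‖ ≤ 1 → ‖w‖ ≤ C * ‖z N‖ ^ 2 ∧
      ∏ p ∈ (primeCutoff N).primesLE, (1 + z N / p) = Complex.exp (z N * L N + w) := by
    intro N
    by_cases h : ‖z N‖ ≤ 1
    · obtain ⟨w, hw⟩ := hC _ (z N) (hprime N) h
      exact ⟨w, fun _ => hw⟩
    · exact ⟨0, fun h' => absurd h' h⟩
  choose w hw using hex
  have hzle : ∀ᶠ N in atTop, 0 < s N ∧ ‖z N‖ ≤ |t| / s N ∧ ‖z N‖ ≤ 1 := by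
    filter_upwards [hs.eventually_ge_atTop (max 1 |t|)] with N hN
    have h0 : 0 < s N := lt_of_lt_of_le one_pos ((le_max_left _ _).trans hN)
    have h1 := norm_exp_div_mul_I_sub_one_le t h0
    exact ⟨h0, h1, h1.trans (div_le_one_of_le₀ ((le_max_right _ _).trans hN) h0.le)⟩
  have ht0 : Tendsto (fun N => |t| / s N) atTop (nhds 0) := tendsto_const_nhds.div_atTop hs
  have hw0 : Tendsto w atTop (nhds 0) := by
    have h1 : Tendsto (fun N => C * (|t| / s N) ^ 2) atTop (nhds 0) := by
      simpa using (ht0.pow 2).const_mul C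
    refine squeeze_zero_norm' ?_ h1
    filter_upwards [hzle] with N ⟨_, hN, hN1⟩
    exact (hw N hN1).1.trans (by gcongr)
  have hr0 : Tendsto (fun N => z N * ((L N - s N ^ 2 : ℝ) : ℂ)) atTop (nhds 0) := by
    have h1 : Tendsto (fun N => |t| * |(L N - Real.log (Real.log N)) / s N|) atTop (nhds 0) := by
      simpa using tendsto_sum_inv_primeCutoff_sub_log_log_div_sqrt.abs.const_mul |t|
    refine squeeze_zero_norm' ?_ h1
    filter_upwards [hzle, tendsto_log_log_natCast.eventually_ge_atTop 0] with N ⟨h0, hN, hN1⟩ hl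
    rw [norm_mul, Complex.norm_real, Real.norm_eq_abs, Real.sq_sqrt hl, abs_div, abs_of_pos h0,
      ← mul_div_assoc, mul_div_right_comm]
    gcongr
  have hmain := (tendsto_exp_sub_one_sub_div t).comp hs
  have hexp := (Complex.continuous_exp.tendsto _).comp ((hmain.add hr0).add hw0)
  rw [add_zero, add_zero] at hexp
  refine hexp.congr' ?_
  filter_upwards [hzle] with N ⟨h0, _, hN1⟩
  have hsC : (s N : ℂ) ≠ 0 := by exact_mod_cast h0.ne'
  rw [(hw N hN1).2, ← Complex.exp_add]
  simp only [Function.comp, hz]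
  congr 1
  push_cast
  field_simp
  ring

/-- The averages of the exponentials of the number of prime divisors below the cutoff, centred and
normalized, tend to the characteristic function of the standard normal law. -/
lemma tendsto_average_exp_primeCutoff (t : ℝ) :
    Tendsto (fun N : ℕ => (∑ m ∈ Finset.Icc 1 N, Complex.exp
      (t * (((((primeCutoff N).primesLE.filter (· ∣ m)).card : ℝ) - Real.log (Real.log N)) /
        √(Real.log (Real.log N)) : ℝ) * Complex.I)) / N) atTop
      (nhds (Complex.exp (-t ^ 2 / 2))) := by
  have hs : Tendsto (fun N : ℕ => √(Real.log (Real.log N))) atTop atTop :=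
    tendsto_sqrt_atTop.comp tendsto_log_log_natCast
  obtain ⟨s, hsdef⟩ : ∃ s : ℕ → ℝ, s = fun N : ℕ => √(Real.log (Real.log N)) := ⟨_, rfl⟩
  rw [← hsdef] at hs
  have hsN : ∀ N : ℕ, √(Real.log (Real.log N)) = s N := fun N => by rw [hsdef]
  obtain ⟨L, hL⟩ : ∃ L : ℕ → ℝ, L = fun N => ∑ p ∈ (primeCutoff N).primesLE, (p : ℝ)⁻¹ :=
    ⟨_, rfl⟩
  have hLlim := tendsto_sum_inv_primeCutoff_sub_log_log_div_sqrt
  have hmain := tendsto_exp_neg_mul_prod_primeCutoff t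
  simp only [hsN] at hLlim hmain ⊢
  have hbound : Tendsto (fun N : ℕ => Real.exp 1 * (√N)⁻¹ +
      Real.exp (-(s N * (s N - Real.exp 1 * |t| - Real.exp 1 * |t| * ((s N)⁻¹ *
        ((L N - Real.log (Real.log N)) / s N)))))) atTop (nhds 0) := by
    have h1 : Tendsto (fun N : ℕ => Real.exp 1 * (√(N : ℝ))⁻¹) atTop (nhds 0) := by
      simpa using ((tendsto_sqrt_atTop.comp
        (tendsto_natCast_atTop_atTop (R := ℝ))).inv_tendsto_atTop).const_mul (Real.exp 1)
    have h2 : Tendsto (fun N : ℕ => Real.exp 1 * |t| * ((s N)⁻¹ *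
        ((L N - Real.log (Real.log N)) / s N))) atTop (nhds 0) := by
      rw [hL]
      simpa using (hs.inv_tendsto_atTop.mul hLlim).const_mul (Real.exp 1 * |t|)
    have h3 := (tendsto_atTop_add_const_right atTop (-(Real.exp 1 * |t|)) hs).atTop_add h2.neg
    have h4 := Real.tendsto_exp_neg_atTop_nhds_zero.comp (hs.atTop_mul_atTop₀ h3)
    have h5 := h1.add h4
    rw [add_zero] at h5
    refine h5.congr fun N => ?_
    simp only [Function.comp, sub_eq_add_neg]
  rw [← tendsto_sub_nhds_zero_iff] at hmain ⊢
  have hlim := (squeeze_zero_norm' (f := fun N : ℕ =>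
    (∑ m ∈ Finset.Icc 1 N, Complex.exp
      (t * (((((primeCutoff N).primesLE.filter (· ∣ m)).card : ℝ) - Real.log (Real.log N)) /
        s N : ℝ) * Complex.I)) / N - Complex.exp (-(t * s N * Complex.I)) *
      ∏ p ∈ (primeCutoff N).primesLE,
        (1 + (Complex.exp (t / s N * Complex.I) - 1) / p)) ?_ hbound).add hmain
  · rw [add_zero] at hlim
    exact hlim.congr fun N => by ring
  · filter_upwards [hs.eventually_ge_atTop (max 1 |t|), eventually_ge_atTop 3,
      tendsto_log_log_natCast.eventually_ge_atTop 0] with N hN hN3 hl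
    have hs1 : 1 ≤ s N := (le_max_left _ _).trans hN
    have hs0 : 0 < s N := by linarith
    have hsC : (s N : ℂ) ≠ 0 := by exact_mod_cast hs0.ne'
    have hst : |t| ≤ s N := (le_max_right _ _).trans hN
    have hsq : Real.log (Real.log N) = s N ^ 2 := by rw [← hsN, Real.sq_sqrt hl]
    have hN0 : (0 : ℝ) < N := by positivity
    have hz := norm_exp_div_mul_I_sub_one_le t hs0
    obtain ⟨z, hzdef⟩ : ∃ z, z = Complex.exp (t / s N * Complex.I) - 1 := ⟨_, rfl⟩
    rw [← hzdef] at hz ⊢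
    have hz1 : ‖z‖ ≤ 1 := hz.trans (div_le_one_of_le₀ hst hs0.le)
    have h1 : ∀ m, Complex.exp
        (t * (((((primeCutoff N).primesLE.filter (· ∣ m)).card : ℝ) - Real.log (Real.log N)) /
        s N : ℝ) * Complex.I) = Complex.exp (-(t * s N * Complex.I)) *
          (1 + z) ^ ((primeCutoff N).primesLE.filter (· ∣ m)).card := by
      intro m
      rw [hzdef, add_sub_cancel, ← Complex.exp_nat_mul, ← Complex.exp_add, hsq]
      congr 1
      push_cast
      field_simp
      ring
    simp_rw [h1]
    rw [← Finset.mul_sum, mul_div_assoc, ← mul_sub, norm_mul]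
    have h2 : ‖Complex.exp (-(t * s N * Complex.I))‖ = 1 := by
      have := Complex.norm_exp_ofReal_mul_I (-(t * s N))
      rwa [Complex.ofReal_neg, Complex.ofReal_mul, neg_mul] at this
    have hY : 1 ≤ Real.exp (Real.log N / (2 * Real.log (Real.log N))) :=
      Real.one_le_exp (div_nonneg (Real.log_natCast_nonneg N) (by positivity))
    have hcard : ((primeCutoff N).primesLE.card : ℝ) ≤
        Real.exp (Real.log N / (2 * Real.log (Real.log N))) := by
      refine le_trans ?_ (primeCutoff_le_exp N)
      rw [Nat.primesLE_eq_filter_Icc_one]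
      exact_mod_cast (Finset.card_filter_le _ _).trans (by simp)
    rw [h2, one_mul]
    refine (norm_average_pow_sub_prod_le (fun p hp => Nat.prime_of_mem_primesLE hp)
      (by omega) hz1 (Real.log (Real.log N)) hY hcard).trans ?_
    rw [exp_log_div_rpow_log_log hN3]
    have hLN : ∑ p ∈ (primeCutoff N).primesLE, (p : ℝ)⁻¹ = L N := by rw [hL]
    have hL0 : 0 ≤ L N := by rw [← hLN]; positivity
    rw [hLN]
    refine add_le_add (le_of_eq ?_) (Real.exp_le_exp.2 ?_)
    · have : (N : ℝ) = √N * √N := (Real.mul_self_sqrt hN0.le).symm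
      have hsN0 : √(N : ℝ) ≠ 0 := (Real.sqrt_pos.2 hN0).ne'
      rw [mul_div_assoc]
      congr 1
      rw [div_eq_iff hN0.ne']
      nth_rewrite 3 [this]
      field_simp
    · calc Real.exp 1 * ‖z‖ * L N - Real.log (Real.log N)
          ≤ Real.exp 1 * (|t| / s N) * L N - Real.log (Real.log N) := by gcongr
        _ = _ := by
          rw [hsq]
          field_simp
          ring

lemma sum_card_filter_dvd_div_le (P : Finset ℕ) (N : ℕ) :
    (∑ m ∈ Finset.Icc 1 N, ((P.filter (· ∣ m)).card : ℝ)) / N ≤ ∑ p ∈ P, (p : ℝ)⁻¹ := by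
  rcases Nat.eq_zero_or_pos N with rfl | hN
  · simpa using Finset.sum_nonneg fun p _ => by positivity
  have hN0 : (0 : ℝ) < N := by exact_mod_cast hN
  rw [div_le_iff₀ hN0, Finset.sum_mul]
  simp_rw [Finset.natCast_card_filter]
  rw [Finset.sum_comm]
  refine Finset.sum_le_sum fun p _ => ?_
  have h : ∑ m ∈ Finset.Icc 1 N, (if p ∣ m then (1 : ℝ) else 0) = (N / p : ℕ) := by
    rw [Finset.sum_boole, ← Nat.Ioc_filter_dvd_card_eq_div]
    rfl
  rw [h, inv_mul_eq_div]
  exact Nat.cast_div_le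

lemma card_primeFactors_eq {m N : ℕ} (hm : m ∈ Finset.Icc 1 N) :
    m.primeFactors.card = (N.primesLE.filter (· ∣ m)).card := by
  rw [Finset.mem_Icc] at hm
  congr 1
  ext p
  rw [Nat.mem_primeFactors, Finset.mem_filter, Nat.mem_primesLE]
  constructor
  · rintro ⟨hp, hd, -⟩
    exact ⟨⟨(Nat.le_of_dvd hm.1 hd).trans hm.2, hp⟩, hd⟩
  · rintro ⟨⟨-, hp⟩, hd⟩
    exact ⟨hp, hd, by omega⟩

/-- Comparison of the normalization at `l'` with the one at a nearby `l`. -/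
lemma abs_sub_div_sqrt_sub_le {l l' w f : ℝ} (hl : 2 ≤ l) (hl' : l - 1 ≤ l') (hl'l : l' ≤ l)
    (hw : 0 ≤ w) (hf : f ≤ w) :
    |(w - l') / √l' - (f - l) / √l| ≤ 2 * w / √l ^ 3 + 1 / √l + (w - f) / √l := by
  obtain ⟨s, hs⟩ : ∃ s, s = √l := ⟨_, rfl⟩
  obtain ⟨r, hr⟩ : ∃ r, r = √l' := ⟨_, rfl⟩
  have hs2 : s ^ 2 = l := by rw [hs, Real.sq_sqrt (by linarith)]
  have hr2 : r ^ 2 = l' := by rw [hr, Real.sq_sqrt (by linarith)]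
  have hs0 : 0 < s := by rw [hs]; exact Real.sqrt_pos.2 (by linarith)
  have hr0 : 0 < r := by rw [hr]; exact Real.sqrt_pos.2 (by linarith)
  have hrs : r ≤ s := by rw [hs, hr]; exact Real.sqrt_le_sqrt hl'l
  have hsr : s / 2 ≤ r := by nlinarith
  have hd : s - r ≤ 1 / s := by
    rw [le_div_iff₀ hs0]; nlinarith
  have hd0 : 0 ≤ s - r := by linarith
  rw [← hs, ← hr, ← hs2, ← hr2]
  have e : (w - r ^ 2) / r - (f - s ^ 2) / s = w * ((s - r) / (s * r)) + (s - r) + (w - f) / s := by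
    field_simp
    ring
  have h1 : (s - r) / (s * r) ≤ 2 / s ^ 3 := by
    calc (s - r) / (s * r) ≤ (1 / s) / (s * (s / 2)) := by gcongr
      _ = 2 / s ^ 3 := by field_simp
  have h2 : 0 ≤ (w - f) / s := div_nonneg (by linarith) hs0.le
  have h3 : 0 ≤ (s - r) / (s * r) := by positivity
  rw [e, abs_of_nonneg (by positivity)]
  have h4 : w * ((s - r) / (s * r)) ≤ w * (2 / s ^ 3) := by gcongr
  have h5 : w * (2 / s ^ 3) = 2 * w / s ^ 3 := by ring
  linarith

lemma norm_exp_mul_I_sub_exp_mul_I_le (x y : ℝ) :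
    ‖Complex.exp (x * Complex.I) - Complex.exp (y * Complex.I)‖ ≤ |x - y| := by
  have h : Complex.exp (x * Complex.I) - Complex.exp (y * Complex.I) =
      Complex.exp (y * Complex.I) * (Complex.exp (Complex.I * (x - y : ℝ)) - 1) := by
    rw [mul_sub, ← Complex.exp_add, mul_one]
    congr 2
    push_cast
    ring
  rw [h, norm_mul, Complex.norm_exp_ofReal_mul_I, one_mul]
  exact Real.norm_exp_I_mul_ofReal_sub_one_le

/-- The averages of the exponentials of `(ω(m) - log log m) / √(log log m)` tend to the
characteristic function of the standard normal law. -/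
theorem tendsto_average_exp_primeFactors (t : ℝ) :
    Tendsto (fun N : ℕ => (∑ m ∈ Finset.Icc 1 N, Complex.exp
      (t * (((m.primeFactors.card : ℝ) - Real.log (Real.log m)) /
        √(Real.log (Real.log m)) : ℝ) * Complex.I)) / N) atTop
      (nhds (Complex.exp (-t ^ 2 / 2))) := by
  have hs : Tendsto (fun N : ℕ => √(Real.log (Real.log N))) atTop atTop :=
    tendsto_sqrt_atTop.comp tendsto_log_log_natCast
  have hmain := tendsto_average_exp_primeCutoff t
  have hL := tendsto_sum_inv_prime_sub_log_log_div_sqrt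
  have hL' := tendsto_sum_inv_primeCutoff_sub_log_log_div_sqrt
  obtain ⟨s, hsdef⟩ : ∃ s : ℕ → ℝ, s = fun N : ℕ => √(Real.log (Real.log N)) := ⟨_, rfl⟩
  have hsN : ∀ N : ℕ, √(Real.log (Real.log N)) = s N := fun N => by rw [hsdef]
  obtain ⟨L, hLdef⟩ : ∃ L : ℕ → ℝ, ∀ N, L N = ∑ p ∈ N.primesLE, (p : ℝ)⁻¹ := ⟨_, fun _ => rfl⟩
  simp only [hsN, ← hLdef] at hs hL hL' hmain ⊢
  have hbound : Tendsto (fun N : ℕ => |t| * (2 * L N / s N ^ 3 + 1 / s N +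
      (L N - L (primeCutoff N)) / s N) + 2 * (√N)⁻¹) atTop (nhds 0) := by
    have h1 : Tendsto (fun N : ℕ => 2 * (√(N : ℝ))⁻¹) atTop (nhds 0) := by
      simpa using ((tendsto_sqrt_atTop.comp
        (tendsto_natCast_atTop_atTop (R := ℝ))).inv_tendsto_atTop).const_mul 2
    have hinv := hs.inv_tendsto_atTop
    have h2 := ((hL.mul (hinv.pow 2)).add hinv).const_mul 2
    have h3 := (((h2.add hinv).add (hL.sub hL')).const_mul |t|).add h1
    simp only [ne_eq, OfNat.ofNat_ne_zero, not_false_eq_true, zero_pow, mul_zero, add_zero,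
      sub_zero] at h3
    refine h3.congr' ?_
    filter_upwards [hs.eventually_gt_atTop 0, tendsto_log_log_natCast.eventually_ge_atTop 0]
      with N h0 hl
    have hsq : Real.log (Real.log N) = s N ^ 2 := by rw [← hsN, Real.sq_sqrt hl]
    simp only [Pi.inv_apply, hsq]
    field_simp
    ring
  rw [← tendsto_sub_nhds_zero_iff] at hmain ⊢
  have hlim := (squeeze_zero_norm' (f := fun N : ℕ =>
    (∑ m ∈ Finset.Icc 1 N, Complex.exp
      (t * (((m.primeFactors.card : ℝ) - Real.log (Real.log m)) / s m : ℝ) * Complex.I)) / N -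
    (∑ m ∈ Finset.Icc 1 N, Complex.exp
      (t * (((((primeCutoff N).primesLE.filter (· ∣ m)).card : ℝ) - Real.log (Real.log N)) /
        s N : ℝ) * Complex.I)) / N) ?_ hbound).add hmain
  · rw [add_zero] at hlim
    exact hlim.congr fun N => by ring
  filter_upwards [tendsto_log_log_natCast.eventually_ge_atTop 2, eventually_ge_atTop 3,
    eventually_primeCutoff_le] with N hl hN hcut
  have hN0 : (0 : ℝ) < N := by positivity
  have hs0 : 0 < s N := by rw [← hsN]; exact Real.sqrt_pos.2 (by linarith)
  obtain ⟨P, hP⟩ : ∃ P, P = N.primesLE \ (primeCutoff N).primesLE := ⟨_, rfl⟩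
  have hsub : (primeCutoff N).primesLE ⊆ N.primesLE := Nat.primesLE_mono hcut
  have hcard : ∀ m ∈ Finset.Icc 1 N, (m.primeFactors.card : ℝ) -
      ((primeCutoff N).primesLE.filter (· ∣ m)).card = (P.filter (· ∣ m)).card := by
    intro m hm
    rw [card_primeFactors_eq hm, hP, sub_eq_iff_eq_add, ← Nat.cast_add, Nat.cast_inj,
      ← Finset.card_union_of_disjoint, ← Finset.filter_union, Finset.sdiff_union_of_subset hsub]
    exact Finset.disjoint_filter_filter Finset.sdiff_disjoint
  have hterm : ∀ m ∈ Finset.Icc 1 N, ‖Complex.exp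
      (t * (((m.primeFactors.card : ℝ) - Real.log (Real.log m)) / s m : ℝ) * Complex.I) -
      Complex.exp
      (t * (((((primeCutoff N).primesLE.filter (· ∣ m)).card : ℝ) - Real.log (Real.log N)) /
        s N : ℝ) * Complex.I)‖ ≤
      |t| * (2 / s N ^ 3 * ((N.primesLE.filter (· ∣ m)).card : ℝ) + 1 / s N +
        (s N)⁻¹ * ((P.filter (· ∣ m)).card : ℝ)) + if m ≤ N.sqrt then 2 else 0 := by
    intro m hm
    obtain ⟨hm1, hmN⟩ := Finset.mem_Icc.1 hm
    split_ifs with hmsqrt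
    · refine le_add_of_nonneg_of_le (by positivity) ?_
      refine (norm_sub_le _ _).trans ?_
      rw [← Complex.ofReal_mul, ← Complex.ofReal_mul, Complex.norm_exp_ofReal_mul_I,
        Complex.norm_exp_ofReal_mul_I]
      norm_num
    · rw [add_zero, ← Complex.ofReal_mul, ← Complex.ofReal_mul]
      refine (norm_exp_mul_I_sub_exp_mul_I_le _ _).trans ?_
      rw [← mul_sub, abs_mul]
      refine mul_le_mul_of_nonneg_left ?_ (abs_nonneg t)
      have hm0 : (0 : ℝ) < m := by exact_mod_cast hm1
      have hNm : (N : ℝ) ≤ m ^ 2 := by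
        have := Nat.sqrt_lt'.1 (not_le.1 hmsqrt)
        exact_mod_cast this.le
      have hlogN : 0 < Real.log N := Real.log_pos (by exact_mod_cast (by omega : 1 < N))
      have hlog : Real.log N / 2 ≤ Real.log m := by
        have := Real.log_le_log hN0 hNm
        rw [Real.log_pow] at this
        push_cast at this
        linarith
      have hle : Real.log (Real.log m) ≤ Real.log (Real.log N) :=
        Real.log_le_log (by linarith) (Real.log_le_log hm0 (by exact_mod_cast hmN))
      have hge : Real.log (Real.log N) - 1 ≤ Real.log (Real.log m) := by
        have := Real.log_le_log (by linarith) hlog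
        rw [Real.log_div hlogN.ne' two_ne_zero] at this
        linarith [Real.log_two_lt_d9]
      have hdiff := hcard m hm
      have hnn : (0 : ℝ) ≤ (P.filter (· ∣ m)).card := Nat.cast_nonneg _
      have := abs_sub_div_sqrt_sub_le (w := m.primeFactors.card)
        (f := ((primeCutoff N).primesLE.filter (· ∣ m)).card) hl hge hle (Nat.cast_nonneg _)
        (by linarith)
      rw [hsN, hsN, hdiff, card_primeFactors_eq hm] at this
      rw [card_primeFactors_eq hm]
      refine this.trans (le_of_eq ?_)
      ring
  have hsumP : ∑ p ∈ P, (p : ℝ)⁻¹ = L N - L (primeCutoff N) := by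
    rw [hLdef, hLdef, hP, eq_sub_iff_add_eq, Finset.sum_sdiff hsub]
  have hsmall : (∑ m ∈ Finset.Icc 1 N, if m ≤ N.sqrt then (2 : ℝ) else 0) / N ≤ 2 * (√N)⁻¹ := by
    rw [← Finset.sum_filter, Finset.sum_const, nsmul_eq_mul]
    have h1 : ((Finset.Icc 1 N).filter (· ≤ N.sqrt)).card ≤ N.sqrt := by
      calc _ ≤ (Finset.Icc 1 N.sqrt).card := Finset.card_le_card fun m hm => by
            rw [Finset.mem_filter, Finset.mem_Icc] at hm
            exact Finset.mem_Icc.2 ⟨hm.1.1, hm.2⟩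
        _ = _ := by simp
    have h2 : (((Finset.Icc 1 N).filter (· ≤ N.sqrt)).card : ℝ) ≤ √N :=
      (Nat.cast_le.2 h1).trans (Real.nat_sqrt_le_real_sqrt)
    have h3 : (√(N : ℝ))⁻¹ = √N / N := by
      rw [eq_div_iff hN0.ne', inv_mul_eq_div, Real.div_sqrt]
    rw [h3, mul_comm, mul_div_assoc]
    gcongr
  have hA := sum_card_filter_dvd_div_le N.primesLE N
  have hB := sum_card_filter_dvd_div_le P N
  rw [← hLdef] at hA
  rw [hsumP] at hB
  rw [← sub_div, ← Finset.sum_sub_distrib, norm_div, Complex.norm_natCast]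
  calc _ ≤ (∑ m ∈ Finset.Icc 1 N, (|t| * (2 / s N ^ 3 * ((N.primesLE.filter (· ∣ m)).card : ℝ) +
        1 / s N + (s N)⁻¹ * ((P.filter (· ∣ m)).card : ℝ)) +
        if m ≤ N.sqrt then (2 : ℝ) else 0)) / (N : ℝ) := by
        gcongr
        exact norm_sum_le_of_le _ hterm
    _ = |t| * (2 / s N ^ 3 *
          ((∑ m ∈ Finset.Icc 1 N, ((N.primesLE.filter (· ∣ m)).card : ℝ)) / N) + 1 / s N +
          (s N)⁻¹ * ((∑ m ∈ Finset.Icc 1 N, ((P.filter (· ∣ m)).card : ℝ)) / N)) +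
          (∑ m ∈ Finset.Icc 1 N, if m ≤ N.sqrt then (2 : ℝ) else 0) / N := by
        rw [Finset.sum_add_distrib, ← Finset.mul_sum, Finset.sum_add_distrib,
          Finset.sum_add_distrib, ← Finset.mul_sum, ← Finset.mul_sum, Finset.sum_const,
          Nat.card_Icc, Nat.add_sub_cancel, nsmul_eq_mul]
        generalize ∑ m ∈ Finset.Icc 1 N, ((N.primesLE.filter (· ∣ m)).card : ℝ) = A
        generalize ∑ m ∈ Finset.Icc 1 N, ((P.filter (· ∣ m)).card : ℝ) = B
        generalize (∑ m ∈ Finset.Icc 1 N, if m ≤ N.sqrt then (2 : ℝ) else 0) = D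
        field_simp
    _ ≤ |t| * (2 / s N ^ 3 * L N + 1 / s N + (s N)⁻¹ * (L N - L (primeCutoff N))) +
          2 * (√N)⁻¹ := by gcongr
    _ = _ := by ring

open MeasureTheory ProbabilityTheory in
lemma gaussianReal_zero_one_Icc_toReal {a b : ℝ} (hab : a ≤ b) :
    (gaussianReal 0 1 (Set.Icc a b)).toReal =
      (1 / √(2 * π)) * ∫ t in a..b, Real.exp (-t ^ 2 / 2) := by
  rw [gaussianReal_apply_eq_integral _ one_ne_zero, ENNReal.toReal_ofReal
    (setIntegral_nonneg measurableSet_Icc fun _ _ => gaussianPDFReal_nonneg _ _ _),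
    integral_Icc_eq_integral_Ioc, ← intervalIntegral.integral_of_le hab,
    ← intervalIntegral.integral_const_mul]
  simp [gaussianPDFReal]

open MeasureTheory ProbabilityTheory in
/-- A criterion for a sequence to have a standard normal distribution function, in terms of averages
of its exponentials. -/
theorem tendsto_card_div_of_tendsto_average_exp {h : ℕ → ℝ}
    (hh : ∀ t : ℝ, Tendsto
      (fun N : ℕ => (∑ m ∈ Finset.Icc 1 N, Complex.exp (t * h m * Complex.I)) / N) atTop
      (nhds (Complex.exp (-t ^ 2 / 2)))) {a b : ℝ} (hab : a ≤ b) :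
    Tendsto (fun N : ℕ => (((Finset.Icc 1 N).filter fun m => a ≤ h m ∧ h m ≤ b).card : ℝ) / N)
      atTop (nhds ((1 / √(2 * π)) * ∫ t in a..b, Real.exp (-t ^ 2 / 2))) := by
  let ν : ℕ → Measure ℝ := fun N =>
    ((N + 1 : ℕ) : ENNReal)⁻¹ • ∑ m ∈ Finset.Icc 1 (N + 1), Measure.dirac (h m)
  have hν : ∀ N, IsProbabilityMeasure (ν N) := fun N => ⟨by
    simp only [ν, Measure.smul_apply, Measure.finsetSum_apply, measure_univ, smul_eq_mul,
      Finset.sum_const, Nat.card_Icc, Nat.add_sub_cancel, nsmul_eq_mul, mul_one]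
    exact ENNReal.inv_mul_cancel (by simp) (ENNReal.natCast_ne_top _)⟩
  let μ : ℕ → ProbabilityMeasure ℝ := fun N => ⟨ν N, hν N⟩
  let γ : ProbabilityMeasure ℝ := ⟨gaussianReal 0 1, inferInstance⟩
  have hconv : Tendsto μ atTop (nhds γ) := by
    refine ProbabilityMeasure.tendsto_of_tendsto_charFun fun t => ?_
    have h1 : charFun (γ : Measure ℝ) t = Complex.exp (-t ^ 2 / 2) := by
      change charFun (gaussianReal 0 1) t = _
      rw [charFun_gaussianReal]
      simp [neg_div]
    rw [h1]
    refine ((hh t).comp (tendsto_add_atTop_nat 1)).congr fun N => ?_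
    change _ = charFun (ν N) t
    rw [charFun_apply_real, integral_smul_measure, integral_finsetSum_measure]
    · simp_rw [integral_dirac]
      simp [div_eq_inv_mul, ENNReal.toReal_inv, ENNReal.toReal_add]
    · exact fun m _ => integrable_dirac (by simp)
  have hfr : (γ : Measure ℝ) (frontier (Set.Icc a b)) = 0 := by
    rw [frontier_Icc hab]
    have : NullSingletonClass (gaussianReal 0 1) := nullSingletonClass_gaussianReal one_ne_zero
    exact (Set.toFinite {a, b}).measure_zero (gaussianReal 0 1)
  have h2 := ProbabilityMeasure.tendsto_measure_of_null_frontier_of_tendsto' hconv hfr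
  have h3 := (ENNReal.tendsto_toReal (measure_ne_top (γ : Measure ℝ) (Set.Icc a b))).comp h2
  rw [show ((γ : Measure ℝ) (Set.Icc a b)).toReal = _ from
    gaussianReal_zero_one_Icc_toReal hab] at h3
  rw [← tendsto_add_atTop_iff_nat 1]
  refine h3.congr fun N => ?_
  change (ν N (Set.Icc a b)).toReal = _
  simp only [ν, Measure.smul_apply, Measure.finsetSum_apply, smul_eq_mul,
    Measure.dirac_apply' _ measurableSet_Icc, Set.indicator_apply, Pi.one_apply]
  rw [Finset.sum_boole, ENNReal.toReal_mul, ENNReal.toReal_inv, ENNReal.toReal_natCast,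
    ENNReal.toReal_natCast, ← div_eq_inv_mul]
  rfl

/-- A limit of averages along the integers gives a limit of averages along the reals. -/
lemma tendsto_card_floor_div {p : ℕ → Prop} [DecidablePred p] {c : ℝ}
    (hp : Tendsto (fun N : ℕ => (((Finset.Icc 1 N).filter p).card : ℝ) / N) atTop (nhds c)) :
    Tendsto (fun x : ℝ => (((Finset.Icc 1 ⌊x⌋₊).filter p).card : ℝ) / x) atTop (nhds c) := by
  have h1 := (hp.comp tendsto_nat_floor_atTop (α := ℝ)).mul (tendsto_nat_floor_div_atTop (R := ℝ))
  rw [mul_one] at h1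
  refine h1.congr' ?_
  filter_upwards [eventually_ge_atTop 1] with x hx
  have : (⌊x⌋₊ : ℝ) ≠ 0 := by
    exact_mod_cast (Nat.floor_pos.2 hx).ne'
  simp only [Function.comp]
  field_simp

/-- Erdős–Kac theorem: for fixed `a < b`,
`(1/x)·|{n ≤ x : a ≤ (ω(n) − log log n)/√(log log n) ≤ b}| → Φ(a,b)` as `x → ∞`, where
`Φ(a,b) = (1/√(2π)) ∫_a^b e^{−t²/2} dt`. -/
theorem erdos_kac (a b : ℝ) (hab : a < b) :
    Tendsto
      (fun x : ℝ =>
        (((Finset.Icc 1 ⌊x⌋₊).filter fun n : ℕ =>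
            a ≤ ((n.primeFactors.card : ℝ) - Real.log (Real.log n)) /
                  Real.sqrt (Real.log (Real.log n)) ∧
            ((n.primeFactors.card : ℝ) - Real.log (Real.log n)) /
                  Real.sqrt (Real.log (Real.log n)) ≤ b).card : ℝ) / x)
      atTop
      (nhds ((1 / Real.sqrt (2 * π)) * ∫ t in a..b, Real.exp (-t ^ 2 / 2))) := by
  exact tendsto_card_floor_div
    (tendsto_card_div_of_tendsto_average_exp tendsto_average_exp_primeFactors hab.le)
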